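/- Let B be an instance of (2,2)-E3-SAT, let J′ be the extended TAP-SS instance obtained from B by the gadget construction described, and let J″ be obtained from J′ by reordering each q_j's preference list so that the relative order of s_j^1, s_j^2, s_j^3 agrees with the master list of schools ⟨S_0⟩ ⟨S_1⟩ … ⟨S_{n−1}⟩ ⟨S^4⟩ ⟨G⟩, where for each i, ⟨S_i⟩ denotes the sequence y_{4i}, s(x_{4i}), s(x_{4i+3}), y_{4i+3}, s(x_{4i+2}), y_{4i+1}, s(x_{4i+1}), y_{4i+2}, ⟨S^4⟩ is an arbitrary fixed order of the schools s_j^4, and ⟨G⟩ is an arbitrary fixed order of the schools g(a). Then every applicant's preference list in J″ is the restriction of this single master list of schools, and B admits a satisfying truth assignment if and only if J″ admits a stable matching. -/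

import Mathlib

/-- The three subjects. -/
inductive Subj : Type where
  | F | I | M
deriving DecidableEq

/-- An instance of (2,2)-E3-SAT with variables `Fin n` and clauses `Fin m`:
`clause j t` is the literal (variable, polarity) in position `t` of clause `j`;
`occurs v b o` is the (clause, position) of the `o`-th occurrence of the literal
`(v, b)`, and `occInv` is its two-sided inverse, so that each clause has exactly
3 literals and each literal occurs exactly twice. -/
structure E3SAT (n m : ℕ) where
  clause : Fin m → Fin 3 → Fin n × Bool
  occurs : Fin n → Bool → Fin 2 → Fin m × Fin 3
  occInv : Fin m → Fin 3 → Fin n × Bool × Fin 2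
  clause_occurs : ∀ v b o, clause (occurs v b o).1 (occurs v b o).2 = (v, b)
  occurs_occInv : ∀ j t, occurs (occInv j t).1 (occInv j t).2.1 (occInv j t).2.2 = (j, t)
  occInv_occurs : ∀ v b o, occInv (occurs v b o).1 (occurs v b o).2 = (v, b, o)

/-- `f` is a satisfying truth assignment of `B`. -/
def E3SAT.Satisfies {n m : ℕ} (B : E3SAT n m) (f : Fin n → Bool) : Prop :=
  ∀ j : Fin m, ∃ t : Fin 3, f (B.clause j t).1 = (B.clause j t).2
/-- An instance of TAP-SS: like TAP but each school has a separate preference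
list of applicants for each subject. -/
structure TAPSS (A : Type*) (S : Type*) (P : Type*) where
  ptype : A → Finset P
  prefA : A → List S
  cap : S → P → ℕ
  prefSp : S → P → List A

namespace TAPSS

variable {A S P : Type*} [DecidableEq A] [DecidableEq S] [DecidableEq P] (J : TAPSS A S P)

def IsAssignment (M : Finset (A × S)) : Prop :=
  (∀ x ∈ M, x.2 ∈ J.prefA x.1) ∧
  ∀ a s s', (a, s) ∈ M → (a, s') ∈ M → s = s'

def Mp (M : Finset (A × S)) (s : S) (p : P) : Finset A :=
  (M.filter (fun x => x.2 = s ∧ p ∈ J.ptype x.1)).image Prod.fst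

def Mpr (M : Finset (A × S)) (s : S) (p r : P) : Finset A :=
  (M.filter (fun x => x.2 = s ∧ J.ptype x.1 = {p, r})).image Prod.fst

def IsMatching (M : Finset (A × S)) : Prop :=
  J.IsAssignment M ∧ ∀ s p, (J.Mp M s p).card ≤ J.cap s p

def Undersub (M : Finset (A × S)) (s : S) (p : P) : Prop :=
  (J.Mp M s p).card < J.cap s p

def PrefersA (a : A) (s s' : S) : Prop :=
  s ∈ J.prefA a ∧ s' ∈ J.prefA a ∧ (J.prefA a).idxOf s < (J.prefA a).idxOf s'

/-- School `s` prefers `a` to `a'` in subject `p`. -/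
def PrefersS (s : S) (p : P) (a a' : A) : Prop :=
  a ∈ J.prefSp s p ∧ a' ∈ J.prefSp s p ∧
    (J.prefSp s p).idxOf a < (J.prefSp s p).idxOf a'

def Unassigned (M : Finset (A × S)) (a : A) : Prop := ∀ s, (a, s) ∉ M

def Blocks (M : Finset (A × S)) (a : A) (s : S) : Prop :=
  s ∈ J.prefA a ∧
  (Unassigned M a ∨ ∃ s', (a, s') ∈ M ∧ J.PrefersA a s s') ∧
  ∃ p₁ p₂, p₁ ≠ p₂ ∧ J.ptype a = {p₁, p₂} ∧
    ((J.Undersub M s p₁ ∧ J.Undersub M s p₂) ∨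
     (J.Undersub M s p₁ ∧ ∃ b ∈ J.Mp M s p₂, J.PrefersS s p₂ a b) ∨
     (J.Undersub M s p₂ ∧ ∃ b ∈ J.Mp M s p₁, J.PrefersS s p₁ a b) ∨
     (∃ b ∈ J.Mpr M s p₁ p₂, J.PrefersS s p₁ a b ∧ J.PrefersS s p₂ a b) ∨
     (∃ b₁ ∈ J.Mp M s p₁, ∃ b₂ ∈ J.Mp M s p₂,
        b₁ ≠ b₂ ∧ J.PrefersS s p₁ a b₁ ∧ J.PrefersS s p₂ a b₂))

def Stable (M : Finset (A × S)) : Prop :=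
  J.IsMatching M ∧ ∀ a s, ¬ J.Blocks M a s

/-- Every applicant is assigned. -/
def ApplicantComplete (_J : TAPSS A S P) (M : Finset (A × S)) : Prop :=
  ∀ a : A, ∃ s, (a, s) ∈ M

end TAPSS
/-- The applicants of the TAP-SS instance constructed from a (2,2)-E3-SAT instance:
`x i r` is the applicant `x_{4i+r}` of the paper, `q j` is `q_{j+1}` and
`w j t` is `w_{j+1}^{t+1}`. -/
inductive SApp (n m : ℕ) : Type where
  | x (i : Fin n) (r : Fin 4)
  | q (j : Fin m)
  | w (j : Fin m) (t : Fin 3)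
deriving DecidableEq

/-- The schools of the TAP-SS instance constructed from a (2,2)-E3-SAT instance:
`y i r` is the school `y_{4i+r}` of the paper, `s j t` is `s_{j+1}^{t+1}` and
`s4 j` is `s_{j+1}^4`. -/
inductive SSch (n m : ℕ) : Type where
  | y (i : Fin n) (r : Fin 4)
  | s (j : Fin m) (t : Fin 3)
  | s4 (j : Fin m)
deriving DecidableEq

variable {n m : ℕ}

/-- The school `s(x_{4i+r})` housing the literal occurrence that applicant
`x_{4i+r}` corresponds to. -/
def sx (B : E3SAT n m) (i : Fin n) (r : Fin 4) : SSch n m :=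
  if h : r.1 < 2 then
    SSch.s (B.occurs i true ⟨r.1, h⟩).1 (B.occurs i true ⟨r.1, h⟩).2
  else
    SSch.s (B.occurs i false ⟨r.1 - 2, by have := r.2; omega⟩).1
      (B.occurs i false ⟨r.1 - 2, by have := r.2; omega⟩).2

open Subj in
/-- Types of the applicants: all x-applicants are FI, all q- and w-applicants are FM. -/
def ssPtype : SApp n m → Finset Subj
  | .x _ _ => {F, I}
  | .q _ => {F, M}
  | .w _ _ => {F, M}

/-- Preference lists of the applicants. -/
def ssPrefA (B : E3SAT n m) : SApp n m → List (SSch n m)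
  | .x i r =>
      if r = 0 then [.y i 0, sx B i r, .y i 1]
      else if r = 1 then [.y i 1, sx B i r, .y i 2]
      else if r = 2 then [.y i 3, sx B i r, .y i 2]
      else [.y i 0, sx B i r, .y i 3]
  | .q j => [.s j 0, .s j 1, .s j 2]
  | .w j t => [.s j t, .s4 j]

open Subj in
/-- Capacities of the schools. -/
def ssCap : SSch n m → Subj → ℕ
  | .y _ _, p => if p = M then 0 else 1
  | .s _ _, _ => 1
  | .s4 _, p => if p = I then 0 else 1

/-- `⟨X⟩`: the x-applicants in increasing subscript order. -/
def Xlist (n m : ℕ) : List (SApp n m) :=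
  (List.finRange n).flatMap fun i => (List.finRange 4).map fun r => SApp.x i r

/-- `⟨Q⟩`: the q-applicants in increasing subscript order. -/
def Qlist (n m : ℕ) : List (SApp n m) := (List.finRange m).map SApp.q

/-- `⟨W⟩`: the w-applicants ordered by increasing subscript and, within equal
subscript, increasing superscript. -/
def Wlist (n m : ℕ) : List (SApp n m) :=
  (List.finRange m).flatMap fun j => (List.finRange 3).map fun t => SApp.w j t

open Subj in
/-- The subject-specific master lists of applicants:
F: ⟨W⟩ ⟨X⟩ ⟨Q⟩; I: ⟨X̄⟩; M: ⟨Q⟩ ⟨W̄⟩. -/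
def ssMaster (n m : ℕ) : Subj → List (SApp n m)
  | F => Wlist n m ++ Xlist n m ++ Qlist n m
  | I => (Xlist n m).reverse
  | M => Qlist n m ++ (Wlist n m).reverse

/-- The TAP-SS instance `J` constructed from the (2,2)-E3-SAT instance `B`;
each school's preference list for subject `p` is the restriction of the master
list for `p` to the applicants whose type includes `p` and who find the school
acceptable. -/
def ssOf (B : E3SAT n m) : TAPSS (SApp n m) (SSch n m) Subj where
  ptype := ssPtype
  prefA := ssPrefA B
  cap s p := ssCap s p
  prefSp s p := (ssMaster n m p).filter
    (fun a => decide (s ∈ ssPrefA B a) && decide (p ∈ ssPtype a))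

/-- The set of pairs `T_i = {(x_{4i+r}, y_{4i+r}) : 0 ≤ r ≤ 3}`. -/
def ssT (i : Fin n) : Finset (SApp n m × SSch n m) :=
  {(.x i 0, .y i 0), (.x i 1, .y i 1), (.x i 2, .y i 2), (.x i 3, .y i 3)}

/-- The set of pairs `F_i = {(x_{4i+r}, y_{4i+r+1}) : 0 ≤ r ≤ 2} ∪ {(x_{4i+3}, y_{4i})}`. -/
def ssF (i : Fin n) : Finset (SApp n m × SSch n m) :=
  {(.x i 0, .y i 1), (.x i 1, .y i 2), (.x i 2, .y i 3), (.x i 3, .y i 0)}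
/-- The applicants of the extended instance `J′`: `base a` is an original applicant
`a` of `J`, and `p1 a`, `p2 a` are the new applicants `a′` and `a″`. -/
inductive SApp' (n m : ℕ) : Type where
  | base (a : SApp n m)
  | p1 (a : SApp n m)
  | p2 (a : SApp n m)
deriving DecidableEq

/-- The schools of the extended instance `J′`: `base s` is an original school of
`J`, and `g a` is the new school `g(a)` for each original applicant `a`. -/
inductive SSch' (n m : ℕ) : Type where
  | base (s : SSch n m)
  | g (a : SApp n m)
deriving DecidableEq

open Subj in
/-- Types in `J′`: original applicants keep their types; if `a` has type FI then
`a′` has type FM, and if `a` has type FM then `a′` has type FI; `a″` always has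
type IM. -/
def ssPtype' : SApp' n m → Finset Subj
  | .base a => ssPtype a
  | .p1 a => match a with
      | .x _ _ => {F, M}
      | _ => {F, I}
  | .p2 _ => {I, M}

/-- Preference lists in `J′`: `g a` is appended to `a`'s preference list, and the
new applicants `a′`, `a″` find only `g a` acceptable. -/
def ssPrefA' (B : E3SAT n m) : SApp' n m → List (SSch' n m)
  | .base a => (ssPrefA B a).map SSch'.base ++ [.g a]
  | .p1 a => [.g a]
  | .p2 a => [.g a]

/-- Capacities in `J′`: original schools keep their capacities and each new school
`g a` has capacity 1 in every subject. -/
def ssCap' : SSch' n m → Subj → ℕ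
  | .base s, p => ssCap s p
  | .g _, _ => 1

open Subj in
/-- The subject-specific master lists of `J′`:
F: ⟨W⟩ ⟨X⟩ ⟨Q⟩ ⟨X′⟩ ⟨R′⟩; I: ⟨X″⟩ ⟨R′⟩ ⟨R″⟩ ⟨X̄⟩; M: ⟨R″⟩ ⟨Q⟩ ⟨W̄⟩ ⟨X′⟩ ⟨X″⟩,
where `LX1 = ⟨X′⟩`, `LX2 = ⟨X″⟩`, `LR1 = ⟨R′⟩`, `LR2 = ⟨R″⟩` are the chosen fixed
orderings of the sets of new applicants. -/
def ssMaster' (n m : ℕ) (LX1 LX2 LR1 LR2 : List (SApp' n m)) : Subj → List (SApp' n m)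
  | F => (Wlist n m ++ Xlist n m ++ Qlist n m).map SApp'.base ++ LX1 ++ LR1
  | I => LX2 ++ LR1 ++ LR2 ++ ((Xlist n m).reverse).map SApp'.base
  | M => LR2 ++ (Qlist n m ++ (Wlist n m).reverse).map SApp'.base ++ LX1 ++ LX2

/-- The extended TAP-SS instance `J′` constructed from `B` (with chosen orderings
of the new applicants); each school's preference list for subject `p` is the
restriction of the master list for `p` to the applicants whose type includes `p`
and who find the school acceptable. -/
def ssOf' (B : E3SAT n m) (LX1 LX2 LR1 LR2 : List (SApp' n m)) :
    TAPSS (SApp' n m) (SSch' n m) Subj where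
  ptype := ssPtype'
  prefA := ssPrefA' B
  cap s p := ssCap' s p
  prefSp s p := (ssMaster' n m LX1 LX2 LR1 LR2 p).filter
    (fun a => decide (s ∈ ssPrefA' B a) && decide (p ∈ ssPtype' a))

/-- The hypothesis that `LX1, LX2, LR1, LR2` are indeed orderings of the sets
`X′`, `X″`, `R′` and `R″` respectively. -/
def ssOrderings (n m : ℕ) (LX1 LX2 LR1 LR2 : List (SApp' n m)) : Prop :=
  LX1.Perm ((Xlist n m).map SApp'.p1) ∧ LX2.Perm ((Xlist n m).map SApp'.p2) ∧
  LR1.Perm ((Qlist n m ++ Wlist n m).map SApp'.p1) ∧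
  LR2.Perm ((Qlist n m ++ Wlist n m).map SApp'.p2)
/-- The master list of schools `⟨S_0⟩ ⟨S_1⟩ … ⟨S_{n−1}⟩ ⟨S^4⟩ ⟨G⟩`, where
`⟨S_i⟩ = y_{4i}, s(x_{4i}), s(x_{4i+3}), y_{4i+3}, s(x_{4i+2}), y_{4i+1}, s(x_{4i+1}), y_{4i+2}`
and `LS4 = ⟨S^4⟩`, `LG = ⟨G⟩` are the chosen fixed orderings of the `s^4`- and
`g`-schools. -/
def schoolMaster {n m : ℕ} (B : E3SAT n m) (LS4 LG : List (SSch' n m)) :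
    List (SSch' n m) :=
  ((List.finRange n).flatMap fun i =>
    [SSch'.base (.y i 0), .base (sx B i 0), .base (sx B i 3), .base (.y i 3),
     .base (sx B i 2), .base (.y i 1), .base (sx B i 1), .base (.y i 2)])
  ++ LS4 ++ LG

/-- The hypothesis that `LS4` and `LG` are indeed orderings of the set of schools
`s_j^4` and the set of schools `g(a)` respectively. -/
def schoolOrderings (n m : ℕ) (LS4 LG : List (SSch' n m)) : Prop :=
  LS4.Perm ((List.finRange m).map fun j => SSch'.base (SSch.s4 j)) ∧
  LG.Perm ((Xlist n m ++ Qlist n m ++ Wlist n m).map SSch'.g)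

/-- Applicants' preference lists in `J″`: each `q_j`'s list is reordered so that the
relative order of `s_j^1, s_j^2, s_j^3` agrees with the master list of schools
(`g(q_j)` remaining last, in accordance with the master list); all other preference
lists are as in `J′`. -/
def ssPrefA'' {n m : ℕ} (B : E3SAT n m) (LS4 LG : List (SSch' n m)) :
    SApp' n m → List (SSch' n m)
  | .base (.q j) => (schoolMaster B LS4 LG).filter
      (fun c => decide (c ∈ ssPrefA' B (.base (SApp.q j))))
  | a => ssPrefA' B a

/-- The instance `J″`: as `J′` but with the applicants' preference lists replaced
by `ssPrefA''`. -/
def ssOf'' {n m : ℕ} (B : E3SAT n m) (LX1 LX2 LR1 LR2 : List (SApp' n m))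
    (LS4 LG : List (SSch' n m)) : TAPSS (SApp' n m) (SSch' n m) Subj where
  ptype := ssPtype'
  prefA := ssPrefA'' B LS4 LG
  cap s p := ssCap' s p
  prefSp s p := (ssMaster' n m LX1 LX2 LR1 LR2 p).filter
    (fun a => decide (s ∈ ssPrefA'' B LS4 LG a) && decide (p ∈ ssPtype' a))

namespace List

theorem Nodup.idxOf_lt_of_pair_sublist {α : Type*} [DecidableEq α] {l : List α} {a b : α}
    (hl : l.Nodup) (h : [a, b] <+ l) : l.idxOf a < l.idxOf b := by
  have hp : l.Pairwise (fun x y => l.idxOf x < l.idxOf y) := by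
    rw [List.pairwise_iff_getElem]
    intro i j hi hj hij
    rwa [hl.idxOf_getElem, hl.idxOf_getElem]
  simpa using hp.sublist h

theorem pair_sublist_append_iff {α : Type*} {l₁ l₂ : List α} {a b : α} :
    [a, b] <+ l₁ ++ l₂ ↔ [a, b] <+ l₁ ∨ (a ∈ l₁ ∧ b ∈ l₂) ∨ [a, b] <+ l₂ := by
  constructor
  · intro h
    obtain ⟨u, v, huv, hu, hv⟩ := List.sublist_append_iff.1 h
    match u, huv, hu with
    | [], huv, _ => exact Or.inr (Or.inr (by rw [huv]; exact hv))
    | [c], huv, hu =>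
      obtain ⟨rfl, rfl⟩ : a = c ∧ [b] = v := by simpa using huv
      exact Or.inr (Or.inl ⟨singleton_sublist.1 hu, singleton_sublist.1 hv⟩)
    | c :: d :: u, huv, hu =>
      obtain ⟨rfl, rfl, rfl, -⟩ : a = c ∧ b = d ∧ u = [] ∧ v = [] := by simpa using huv
      exact Or.inl hu
  · rintro (h | ⟨ha, hb⟩ | h)
    · exact h.trans (sublist_append_left _ _)
    · exact (singleton_sublist.2 ha).append (singleton_sublist.2 hb)
    · exact h.trans (sublist_append_right _ _)

theorem Nodup.filter_mem_eq_of_sublist {α : Type*} [DecidableEq α] {l L : List α}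
    (hL : L.Nodup) (h : l <+ L) :
    L.filter (fun c => decide (c ∈ l)) = l := by
  have h₁ : l <+ L.filter (fun c => decide (c ∈ l)) := by
    have := h.filter (fun c => decide (c ∈ l))
    rwa [List.filter_eq_self.2 (by simp)] at this
  refine (h₁.eq_of_length_le ?_).symm
  exact (List.subperm_of_subset (hL.filter _) (by intro c; simp)).length_le

end List

namespace TAPSS

variable {A S P : Type*} [DecidableEq A] [DecidableEq S] [DecidableEq P] (J : TAPSS A S P)
  {M : Finset (A × S)}

theorem mem_Mp {s : S} {p : P} {a : A} :
    a ∈ J.Mp M s p ↔ (a, s) ∈ M ∧ p ∈ J.ptype a := by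
  simp only [Mp, Finset.mem_image, Finset.mem_filter]
  constructor
  · rintro ⟨⟨a', s'⟩, ⟨h, rfl, hp⟩, rfl⟩
    exact ⟨h, hp⟩
  · rintro ⟨h, hp⟩
    exact ⟨(a, s), ⟨h, rfl, hp⟩, rfl⟩

/-- A pair does not block if one of the applicant's subjects is full at the school, with
nobody there less preferred in that subject. -/
theorem not_blocks_of_full {a : A} {s : S} {p : P} (hp : p ∈ J.ptype a)
    (hfull : ¬ J.Undersub M s p) (hpref : ∀ b ∈ J.Mp M s p, ¬ J.PrefersS s p a b) :
    ¬ J.Blocks M a s := by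
  rintro ⟨-, -, p₁, p₂, -, ht, hb⟩
  have hMpr : ∀ b ∈ J.Mpr M s p₁ p₂, b ∈ J.Mp M s p := by
    intro b hb
    simp only [Mpr, Finset.mem_image, Finset.mem_filter] at hb
    obtain ⟨⟨b', s'⟩, ⟨h, rfl, hp'⟩, rfl⟩ := hb
    exact J.mem_Mp.2 ⟨h, by simp only at hp'; rw [hp', ← ht]; exact hp⟩
  rw [ht, Finset.mem_insert, Finset.mem_singleton] at hp
  rcases hp with rfl | rfl
  · rcases hb with ⟨h, -⟩ | ⟨h, -⟩ | ⟨-, b, hb, h⟩ | ⟨b, hb, h, -⟩ | ⟨b, hb, c, -, -, h, -⟩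
    · exact hfull h
    · exact hfull h
    · exact hpref b hb h
    · exact hpref b (hMpr b hb) h
    · exact hpref b hb h
  · rcases hb with ⟨-, h⟩ | ⟨-, b, hb, h⟩ | ⟨h, -⟩ | ⟨b, hb, -, h⟩ | ⟨c, -, b, hb, -, -, h⟩
    · exact hfull h
    · exact hpref b hb h
    · exact hfull h
    · exact hpref b (hMpr b hb) h
    · exact hpref b hb h

theorem eq_of_mem_of_cap_le_one {s : S} {p : P} {a b : A} (hM : J.IsMatching M)
    (hc : J.cap s p ≤ 1) (ha : (a, s) ∈ M) (hb : (b, s) ∈ M)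
    (hpa : p ∈ J.ptype a) (hpb : p ∈ J.ptype b) : a = b :=
  Finset.card_le_one.1 ((hM.2 s p).trans hc) a (J.mem_Mp.2 ⟨ha, hpa⟩) b (J.mem_Mp.2 ⟨hb, hpb⟩)

theorem undersub_of_forall {s : S} {p : P} (hc : 0 < J.cap s p)
    (h : ∀ b, (b, s) ∈ M → p ∉ J.ptype b) : J.Undersub M s p := by
  have : J.Mp M s p = ∅ := by
    ext b
    simpa [J.mem_Mp] using h b
  simpa [Undersub, this] using hc

/-- A pair blocks if the only occupant of the school leaves one of the applicant's subjects
free and is less preferred in the other one. -/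
theorem blocks_of_occupant {a b : A} {s : S} {p r : P} (hs : s ∈ J.prefA a)
    (ha : Unassigned M a ∨ ∃ s', (a, s') ∈ M ∧ J.PrefersA a s s')
    (hpr : p ≠ r) (ht : J.ptype a = {p, r}) (hc : 0 < J.cap s p)
    (hb : (b, s) ∈ M) (huniq : ∀ c, (c, s) ∈ M → c = b) (hpb : p ∉ J.ptype b)
    (hrb : r ∈ J.ptype b) (hpref : J.PrefersS s r a b) : J.Blocks M a s :=
  ⟨hs, ha, p, r, hpr, ht, Or.inr <| Or.inl
    ⟨J.undersub_of_forall hc fun c hc' => by rwa [huniq c hc'], b, J.mem_Mp.2 ⟨hb, hrb⟩, hpref⟩⟩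

end TAPSS

variable {B : E3SAT n m}

theorem exists_sx_eq (B : E3SAT n m) (i : Fin n) (r : Fin 4) : ∃ o : Fin 2,
    (o : ℕ) = (if r.1 < 2 then r.1 else r.1 - 2) ∧
    sx B i r = .s (B.occurs i (decide (r.1 < 2)) o).1 (B.occurs i (decide (r.1 < 2)) o).2 := by
  by_cases h : r.1 < 2
  · exact ⟨⟨r.1, h⟩, by simp [h], by simp [sx, h]⟩
  · exact ⟨⟨r.1 - 2, by omega⟩, by simp [h], by simp [sx, h]⟩

theorem exists_sx_eq_s (B : E3SAT n m) (i : Fin n) (r : Fin 4) :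
    ∃ j t, sx B i r = .s j t ∧ B.clause j t = (i, decide (r.1 < 2)) := by
  obtain ⟨o, -, h⟩ := exists_sx_eq B i r
  exact ⟨_, _, h, B.clause_occurs _ _ _⟩

theorem exists_eq_sx (B : E3SAT n m) (j : Fin m) (t : Fin 3) :
    ∃ i r, sx B i r = .s j t ∧ B.clause j t = (i, decide (r.1 < 2)) := by
  obtain ⟨i, b, o, h⟩ : ∃ i b o, B.occurs i b o = (j, t) := ⟨_, _, _, B.occurs_occInv j t⟩
  have hc := B.clause_occurs i b o
  rw [h] at hc
  cases b
  · exact ⟨i, ⟨o + 2, by omega⟩, by simp [sx, h], by simpa using hc⟩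
  · exact ⟨i, ⟨o, by omega⟩, by simp [sx, h, o.2], by simpa [o.2] using hc⟩

theorem sx_inj (B : E3SAT n m) {i i' : Fin n} {r r' : Fin 4} :
    sx B i r = sx B i' r' ↔ i = i' ∧ r = r' := by
  refine ⟨fun h => ?_, by rintro ⟨rfl, rfl⟩; rfl⟩
  obtain ⟨o, ho, hs⟩ := exists_sx_eq B i r
  obtain ⟨o', ho', hs'⟩ := exists_sx_eq B i' r'
  rw [hs, hs', SSch.s.injEq] at h
  have h₁ := B.occInv_occurs i (decide (r.1 < 2)) o
  rw [h.1, h.2, B.occInv_occurs, Prod.mk.injEq, Prod.mk.injEq, decide_eq_decide] at h₁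
  obtain ⟨rfl, hr, rfl⟩ := h₁
  refine ⟨rfl, Fin.ext ?_⟩
  grind

@[simp]
theorem sx_ne_y (B : E3SAT n m) (i i' : Fin n) (r r' : Fin 4) : sx B i r ≠ .y i' r' := by
  obtain ⟨j, t, h, -⟩ := exists_sx_eq_s B i r
  simp [h]

@[simp]
theorem sx_ne_s4 (B : E3SAT n m) (i : Fin n) (r : Fin 4) (j : Fin m) : sx B i r ≠ .s4 j := by
  obtain ⟨j, t, h, -⟩ := exists_sx_eq_s B i r
  simp [h]

@[simp]
theorem mem_Xlist {a : SApp n m} : a ∈ Xlist n m ↔ ∃ i r, a = .x i r := by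
  simp [Xlist, eq_comm]

@[simp]
theorem mem_Qlist {a : SApp n m} : a ∈ Qlist n m ↔ ∃ j, a = .q j := by
  simp [Qlist, eq_comm]

@[simp]
theorem mem_Wlist {a : SApp n m} : a ∈ Wlist n m ↔ ∃ j t, a = .w j t := by
  simp [Wlist, eq_comm]

theorem nodup_Xlist : (Xlist n m).Nodup := by
  rw [Xlist, List.nodup_flatMap]
  refine ⟨fun i _ => (List.nodup_finRange 4).map fun _ _ h => by simpa using h, ?_⟩
  refine (List.nodup_finRange n).imp fun {i i'} h => ?_
  simp [Function.onFun, List.disjoint_left, Ne.symm h]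

theorem nodup_Qlist : (Qlist n m).Nodup :=
  (List.nodup_finRange m).map fun _ _ h => by simpa using h

theorem nodup_Wlist : (Wlist n m).Nodup := by
  rw [Wlist, List.nodup_flatMap]
  refine ⟨fun j _ => (List.nodup_finRange 3).map fun _ _ h => by simpa using h, ?_⟩
  refine (List.nodup_finRange m).imp fun {j j'} h => ?_
  simp [Function.onFun, List.disjoint_left, Ne.symm h]

section Masters

open scoped List

theorem pair_sublist_Xlist (i : Fin n) {r r' : Fin 4} (h : r < r') :
    [SApp.x i r, SApp.x i r'] <+ Xlist n m := by
  have h₁ : [r, r'] <+ List.finRange 4 := by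
    revert r r'; decide
  refine (h₁.map (SApp.x i)).trans ?_
  exact List.sublist_flatten_of_mem (List.mem_map.2 ⟨i, List.mem_finRange i, rfl⟩)

variable {LX1 LX2 LR1 LR2 : List (SApp' n m)} {LS4 LG : List (SSch' n m)}

theorem nodup_ssMaster' (hord : ssOrderings n m LX1 LX2 LR1 LR2) (p : Subj) :
    (ssMaster' n m LX1 LX2 LR1 LR2 p).Nodup := by
  obtain ⟨h₁, h₂, h₃, h₄⟩ := hord
  have hb : Function.Injective (SApp'.base (n := n) (m := m)) := fun _ _ h => by simpa using h
  have hp1 : Function.Injective (SApp'.p1 (n := n) (m := m)) := fun _ _ h => by simpa using h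
  have hp2 : Function.Injective (SApp'.p2 (n := n) (m := m)) := fun _ _ h => by simpa using h
  have hQW : (Qlist n m ++ Wlist n m).Nodup := by
    refine List.nodup_append'.2 ⟨nodup_Qlist, nodup_Wlist, ?_⟩
    simp [List.disjoint_left]
  have n₁ : LX1.Nodup := h₁.nodup_iff.2 (nodup_Xlist.map hp1)
  have n₂ : LX2.Nodup := h₂.nodup_iff.2 (nodup_Xlist.map hp2)
  have n₃ : LR1.Nodup := h₃.nodup_iff.2 (hQW.map hp1)
  have n₄ : LR2.Nodup := h₄.nodup_iff.2 (hQW.map hp2)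
  have nX := (nodup_Xlist (n := n) (m := m)).map hb
  have nQ := (nodup_Qlist (n := n) (m := m)).map hb
  have nW := (nodup_Wlist (n := n) (m := m)).map hb
  have e₁ := fun a => h₁.mem_iff (a := a)
  have e₂ := fun a => h₂.mem_iff (a := a)
  have e₃ := fun a => h₃.mem_iff (a := a)
  have e₄ := fun a => h₄.mem_iff (a := a)
  cases p <;>
    simp only [ssMaster', List.map_append, List.map_reverse, List.nodup_append',
      List.nodup_reverse, n₁, n₂, n₃, n₄, nX, nQ, nW, true_and,
      List.disjoint_left, List.mem_append, List.mem_reverse, e₁, e₂, e₃, e₄, List.mem_map,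
      mem_Xlist, mem_Qlist, mem_Wlist] <;> grind

/-- Every school occurs in the master list of schools. -/
theorem mem_schoolMaster (B : E3SAT n m) (hord' : schoolOrderings n m LS4 LG)
    (c : SSch' n m) : c ∈ schoolMaster B LS4 LG := by
  simp only [schoolMaster, List.mem_append, hord'.1.mem_iff, hord'.2.mem_iff]
  rcases c with (⟨i, r⟩ | ⟨j, t⟩ | j) | a
  · left; left
    refine List.mem_flatMap.2 ⟨i, List.mem_finRange i, ?_⟩
    fin_cases r <;> simp
  · left; left
    obtain ⟨i, r, h, -⟩ := exists_eq_sx B j t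
    refine List.mem_flatMap.2 ⟨i, List.mem_finRange i, ?_⟩
    rw [← h]
    fin_cases r <;> simp
  · simp
  · right
    cases a <;> simp

theorem nodup_schoolMaster (B : E3SAT n m) (hord' : schoolOrderings n m LS4 LG) :
    (schoolMaster B LS4 LG).Nodup := by
  obtain ⟨h₁, h₂⟩ := hord'
  have n₁ : LS4.Nodup :=
    h₁.nodup_iff.2 ((List.nodup_finRange m).map fun _ _ h => by simpa using h)
  have n₂ : LG.Nodup := by
    refine h₂.nodup_iff.2 (List.Nodup.map (fun _ _ h => by simpa using h) ?_)
    simp only [List.nodup_append', nodup_Xlist, nodup_Qlist, nodup_Wlist, true_and,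
      List.disjoint_left, List.mem_append, mem_Xlist, mem_Qlist, mem_Wlist]
    grind
  have e₁ := fun a => h₁.mem_iff (a := a)
  have e₂ := fun a => h₂.mem_iff (a := a)
  simp only [schoolMaster, List.nodup_append', n₁, n₂, true_and, List.nodup_flatMap]
  refine ⟨⟨⟨fun i _ => ?_, (List.nodup_finRange n).imp fun {i i'} h => ?_⟩, ?_⟩, ?_⟩
  · simp [sx_inj, (sx_ne_y B _ _ _ _).symm]
  · simp [Function.onFun, sx_inj, Ne.symm h, (sx_ne_y B _ _ _ _).symm]
  · simp +contextual [List.disjoint_left, e₁, or_imp, (sx_ne_s4 B _ _ _).symm]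
  · simp +contextual [List.disjoint_left, e₁, e₂, or_imp]

theorem base_g_sublist_schoolMaster (B : E3SAT n m) (hord' : schoolOrderings n m LS4 LG)
    (c : SSch n m) (a : SApp n m) : [SSch'.base c, SSch'.g a] <+ schoolMaster B LS4 LG := by
  have hc := mem_schoolMaster B hord' (.base c)
  have ha := mem_schoolMaster B hord' (.g a)
  rw [schoolMaster, List.pair_sublist_append_iff]
  refine Or.inr (Or.inl ?_)
  rw [schoolMaster, List.mem_append] at hc ha
  simp only [hord'.2.mem_iff] at hc
  refine ⟨by simpa using hc, ha.resolve_left ?_⟩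
  simp [hord'.1.mem_iff]

theorem ssPrefA'_sublist_schoolMaster (B : E3SAT n m) (hord' : schoolOrderings n m LS4 LG)
    {a : SApp' n m} (ha : ∀ j, a ≠ .base (.q j)) :
    ssPrefA' B a <+ schoolMaster B LS4 LG := by
  have hg : ∀ a : SApp n m, [SSch'.g a] <+ LG := fun a => by
    rw [List.singleton_sublist, hord'.2.mem_iff]
    cases a <;> simp
  have hg' : ∀ a : SApp n m, [SSch'.g a] <+ schoolMaster B LS4 LG := fun a =>
    (hg a).trans (List.sublist_append_right _ _)
  rcases a with (⟨i, r⟩ | j | ⟨j, t⟩) | a | a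
  · refine List.Sublist.append (List.Sublist.trans ?_ (List.sublist_append_left _ _)) (hg _)
    refine List.Sublist.trans ?_
      (List.sublist_flatten_of_mem (List.mem_map.2 ⟨i, List.mem_finRange i, rfl⟩))
    fin_cases r <;> simp [ssPrefA] <;> grind
  · exact absurd rfl (ha j)
  · refine List.Sublist.append ?_ (hg _)
    refine List.Sublist.append (l₁ := [_]) (r₁ := [_]) ?_ ?_
    · obtain ⟨i, r, h, -⟩ := exists_eq_sx B j t
      rw [List.singleton_sublist, ← h]
      refine List.mem_flatMap.2 ⟨i, List.mem_finRange i, ?_⟩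
      fin_cases r <;> simp
    · rw [List.singleton_sublist, hord'.1.mem_iff]
      simp
  · exact hg' a
  · exact hg' a

theorem ssPrefA''_eq_filter (B : E3SAT n m) (hord' : schoolOrderings n m LS4 LG)
    (a : SApp' n m) : ssPrefA'' B LS4 LG a =
      (schoolMaster B LS4 LG).filter (fun c => decide (c ∈ ssPrefA' B a)) := by
  by_cases ha : ∃ j, a = .base (.q j)
  · obtain ⟨j, rfl⟩ := ha
    rfl
  · push Not at ha
    rw [(nodup_schoolMaster B hord').filter_mem_eq_of_sublist
      (ssPrefA'_sublist_schoolMaster B hord' ha), ssPrefA'']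
    exact ha

theorem mem_ssPrefA'' (hord' : schoolOrderings n m LS4 LG) {a : SApp' n m} {c : SSch' n m} :
    c ∈ ssPrefA'' B LS4 LG a ↔ c ∈ ssPrefA' B a := by
  simp [ssPrefA''_eq_filter B hord', mem_schoolMaster B hord']

theorem ssPrefA''_sublist (B : E3SAT n m) (hord' : schoolOrderings n m LS4 LG)
    (a : SApp' n m) : ssPrefA'' B LS4 LG a <+ schoolMaster B LS4 LG := by
  rw [ssPrefA''_eq_filter B hord']
  exact List.filter_sublist

theorem nodup_ssPrefA'' (B : E3SAT n m) (hord' : schoolOrderings n m LS4 LG)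
    (a : SApp' n m) : (ssPrefA'' B LS4 LG a).Nodup :=
  (nodup_schoolMaster B hord').sublist (ssPrefA''_sublist B hord' a)


theorem not_prefersA_of_pair_sublist (hord' : schoolOrderings n m LS4 LG) {a : SApp' n m}
    {c d : SSch' n m} (h : [d, c] <+ schoolMaster B LS4 LG) :
    ¬ (ssOf'' B LX1 LX2 LR1 LR2 LS4 LG).PrefersA a c d := by
  rintro ⟨hc, hd, hlt⟩
  have h₁ := h.filter (fun c => decide (c ∈ ssPrefA' B a))
  rw [← ssPrefA''_eq_filter B hord', List.filter_eq_self.2] at h₁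
  · exact lt_asymm hlt ((nodup_ssPrefA'' B hord' a).idxOf_lt_of_pair_sublist h₁)
  · simpa using ⟨(mem_ssPrefA'' hord').1 hd, (mem_ssPrefA'' hord').1 hc⟩

theorem prefersA_of_pair_sublist (hord' : schoolOrderings n m LS4 LG) {a : SApp' n m}
    {c d : SSch' n m} (h : [c, d] <+ ssPrefA'' B LS4 LG a) :
    (ssOf'' B LX1 LX2 LR1 LR2 LS4 LG).PrefersA a c d :=
  ⟨h.subset (by simp), h.subset (by simp),
    (nodup_ssPrefA'' B hord' a).idxOf_lt_of_pair_sublist h⟩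

theorem not_prefersA_of_reverse_sublist (hord' : schoolOrderings n m LS4 LG) {a : SApp' n m}
    {c d : SSch' n m} (h : [d, c] <+ ssPrefA'' B LS4 LG a) :
    ¬ (ssOf'' B LX1 LX2 LR1 LR2 LS4 LG).PrefersA a c d :=
  not_prefersA_of_pair_sublist hord' (h.trans (ssPrefA''_sublist B hord' a))

theorem not_prefersS_of_pair_sublist (hord : ssOrderings n m LX1 LX2 LR1 LR2) {p : Subj}
    {c : SSch' n m} {a b : SApp' n m} (h : [b, a] <+ ssMaster' n m LX1 LX2 LR1 LR2 p) :
    ¬ (ssOf'' B LX1 LX2 LR1 LR2 LS4 LG).PrefersS c p a b := by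
  rintro ⟨ha, hb, hlt⟩
  have h₁ := h.filter
    (fun a => decide (c ∈ ssPrefA'' B LS4 LG a) && decide (p ∈ ssPtype' a))
  rw [List.filter_eq_self.2] at h₁
  · exact lt_asymm hlt
      (((nodup_ssMaster' hord p).filter _).idxOf_lt_of_pair_sublist h₁)
  · have ha' := List.of_mem_filter ha
    have hb' := List.of_mem_filter hb
    simp_all

theorem prefersS_of_pair_sublist (hord : ssOrderings n m LX1 LX2 LR1 LR2)
    (hord' : schoolOrderings n m LS4 LG) {p : Subj}
    {c : SSch' n m} {a b : SApp' n m} (h : [a, b] <+ ssMaster' n m LX1 LX2 LR1 LR2 p)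
    (ha : c ∈ ssPrefA' B a) (hb : c ∈ ssPrefA' B b) (hpa : p ∈ ssPtype' a)
    (hpb : p ∈ ssPtype' b) :
    (ssOf'' B LX1 LX2 LR1 LR2 LS4 LG).PrefersS c p a b := by
  have h₁ := h.filter
    (fun a => decide (c ∈ ssPrefA'' B LS4 LG a) && decide (p ∈ ssPtype' a))
  rw [List.filter_eq_self.2 (by simp [mem_ssPrefA'' hord', ha, hb, hpa, hpb])] at h₁
  exact ⟨h₁.subset (by simp), h₁.subset (by simp),
    ((nodup_ssMaster' hord p).filter _).idxOf_lt_of_pair_sublist h₁⟩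

theorem w_x_sublist_masterF (j : Fin m) (t : Fin 3) (i : Fin n) (r : Fin 4) :
    [SApp'.base (.w j t), .base (.x i r)] <+ ssMaster' n m LX1 LX2 LR1 LR2 .F := by
  simp [ssMaster', List.pair_sublist_append_iff]

theorem w_q_sublist_masterF (j j' : Fin m) (t : Fin 3) :
    [SApp'.base (.w j t), .base (.q j')] <+ ssMaster' n m LX1 LX2 LR1 LR2 .F := by
  simp [ssMaster', List.pair_sublist_append_iff]

theorem x_q_sublist_masterF (i : Fin n) (r : Fin 4) (j : Fin m) :
    [SApp'.base (.x i r), .base (.q j)] <+ ssMaster' n m LX1 LX2 LR1 LR2 .F := by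
  simp [ssMaster', List.pair_sublist_append_iff]

theorem x_x_sublist_masterF (i : Fin n) {r r' : Fin 4} (h : r < r') :
    [SApp'.base (.x i r), .base (.x i r')] <+ ssMaster' n m LX1 LX2 LR1 LR2 .F := by
  have := (pair_sublist_Xlist (m := m) i h).map SApp'.base
  simp_all [ssMaster']

theorem x_x_sublist_masterI (i : Fin n) {r r' : Fin 4} (h : r < r') :
    [SApp'.base (.x i r'), .base (.x i r)] <+ ssMaster' n m LX1 LX2 LR1 LR2 .I :=
  ((pair_sublist_Xlist i h).reverse.map SApp'.base).trans (List.sublist_append_right _ _)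

theorem q_w_sublist_masterM (j j' : Fin m) (t : Fin 3) :
    [SApp'.base (.q j'), .base (.w j t)] <+ ssMaster' n m LX1 LX2 LR1 LR2 .M := by
  simp [ssMaster', List.pair_sublist_append_iff]

theorem base_p1_sublist_masterF (hord : ssOrderings n m LX1 LX2 LR1 LR2) (a : SApp n m) :
    [SApp'.base a, .p1 a] <+ ssMaster' n m LX1 LX2 LR1 LR2 .F := by
  cases a <;> simp [ssMaster', List.pair_sublist_append_iff, hord.1.mem_iff, hord.2.2.1.mem_iff]

/-- The subject shared by `p1 a` and `p2 a`. -/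
def sharedSubj : SApp n m → Subj
  | .x _ _ => .M
  | _ => .I

/-- The subject shared by `a` and `p2 a`. -/
def sharedSubj' : SApp n m → Subj
  | .x _ _ => .I
  | _ => .M

theorem p1_p2_sublist (hord : ssOrderings n m LX1 LX2 LR1 LR2) (a : SApp n m) :
    [SApp'.p1 a, .p2 a] <+ ssMaster' n m LX1 LX2 LR1 LR2 (sharedSubj a) := by
  obtain ⟨h₁, h₂, h₃, h₄⟩ := hord
  cases a <;> simp [ssMaster', sharedSubj, List.pair_sublist_append_iff, h₁.mem_iff, h₂.mem_iff,
    h₃.mem_iff, h₄.mem_iff]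

theorem p2_base_sublist (hord : ssOrderings n m LX1 LX2 LR1 LR2) (a : SApp n m) :
    [SApp'.p2 a, .base a] <+ ssMaster' n m LX1 LX2 LR1 LR2 (sharedSubj' a) := by
  obtain ⟨h₁, h₂, h₃, h₄⟩ := hord
  cases a <;> simp [ssMaster', sharedSubj', List.pair_sublist_append_iff, h₁.mem_iff, h₂.mem_iff,
    h₃.mem_iff, h₄.mem_iff]

theorem sharedSubj_ne (a : SApp n m) : sharedSubj a ≠ sharedSubj' a := by
  cases a <;> simp [sharedSubj, sharedSubj']

theorem sharedSubj_ne_F (a : SApp n m) : sharedSubj a ≠ .F := by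
  cases a <;> simp [sharedSubj]

theorem sharedSubj'_ne_F (a : SApp n m) : sharedSubj' a ≠ .F := by
  cases a <;> simp [sharedSubj']

theorem ssPtype'_base (a : SApp n m) : ssPtype' (.base a) = {sharedSubj' a, .F} := by
  cases a <;> simp [ssPtype', ssPtype, sharedSubj', Finset.pair_comm]

theorem ssPtype'_p1 (a : SApp n m) : ssPtype' (.p1 a) = {.F, sharedSubj a} := by
  cases a <;> rfl

theorem ssPtype'_p2 (a : SApp n m) : ssPtype' (.p2 a) = {sharedSubj a, sharedSubj' a} := by
  cases a <;> simp [ssPtype', sharedSubj, sharedSubj', Finset.pair_comm]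

/-- The rank-one `y`-school of `x i r` is `y i (firstY r)`. -/
def firstY : Fin 4 → Fin 4 := ![0, 1, 3, 0]

/-- The rank-three `y`-school of `x i r` is `y i (lastY r)`. -/
def lastY : Fin 4 → Fin 4 := ![1, 2, 2, 3]

theorem ssPrefA_x (B : E3SAT n m) (i : Fin n) (r : Fin 4) :
    ssPrefA B (.x i r) = [.y i (firstY r), sx B i r, .y i (lastY r)] := by
  fin_cases r <;> rfl

theorem mem_ssPrefA'_g {a : SApp' n m} {b : SApp n m} :
    SSch'.g b ∈ ssPrefA' B a ↔ a = .base b ∨ a = .p1 b ∨ a = .p2 b := by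
  cases a <;> simp [ssPrefA', eq_comm]

theorem mem_ssPrefA'_base {a : SApp' n m} {c : SSch n m} :
    SSch'.base c ∈ ssPrefA' B a ↔ ∃ b, a = .base b ∧ c ∈ ssPrefA B b := by
  cases a <;> simp [ssPrefA']

section StableToSat

variable {M : Finset (SApp' n m × SSch' n m)}

/-- In a stable matching, every original applicant is assigned to an original school. -/
theorem exists_base_mem_of_stable (hord : ssOrderings n m LX1 LX2 LR1 LR2)
    (hord' : schoolOrderings n m LS4 LG)
    (hM : (ssOf'' B LX1 LX2 LR1 LR2 LS4 LG).Stable M) (a : SApp n m) :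
    ∃ c ∈ ssPrefA B a, (.base a, .base c) ∈ M := by
  by_contra! hcon
  obtain ⟨hM, hst⟩ := hM
  have hacc : ∀ b c, (b, c) ∈ M → c ∈ ssPrefA' B b := fun b c h =>
    (mem_ssPrefA'' hord').1 (hM.1.1 _ h)
  have hun : ∀ b, b = .base a ∨ b = .p1 a ∨ b = .p2 a → (b, SSch'.g a) ∉ M →
      TAPSS.Unassigned M b := by
    rintro b hb hg c hc
    have hc' := hacc b c hc
    rcases hb with rfl | rfl | rfl
    · simp only [ssPrefA', List.mem_append, List.mem_map, List.mem_singleton] at hc'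
      rcases hc' with ⟨d, hd, rfl⟩ | rfl
      · exact hcon d hd hc
      · exact hg hc
    · exact hg (by simpa [show c = .g a by simpa [ssPrefA'] using hc'] using hc)
    · exact hg (by simpa [show c = .g a by simpa [ssPrefA'] using hc'] using hc)
  have huniq : ∀ b c, (b, SSch'.g a) ∈ M → (c, SSch'.g a) ∈ M → c = b := by
    intro b c hb hc
    obtain ⟨p, hpc, hpb⟩ : ∃ p, p ∈ ssPtype' c ∧ p ∈ ssPtype' b := by
      rcases mem_ssPrefA'_g.1 (hacc _ _ hb) with rfl | rfl | rfl <;>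
      rcases mem_ssPrefA'_g.1 (hacc _ _ hc) with rfl | rfl | rfl <;>
      simp [ssPtype'_base, ssPtype'_p1, ssPtype'_p2]
    exact TAPSS.eq_of_mem_of_cap_le_one _ hM (le_refl 1) hc hb hpc hpb
  have hne : ∀ b c : SApp' n m, c ≠ b → (b, SSch'.g a) ∈ M → (c, SSch'.g a) ∉ M :=
    fun b c h hb hc => h (huniq b c hb hc)
  have n₁ := sharedSubj_ne a
  have n₂ := sharedSubj_ne_F a
  have n₃ := sharedSubj'_ne_F a
  have hpg : ∀ b, b = .base a ∨ b = .p1 a ∨ b = .p2 a → SSch'.g a ∈ ssPrefA'' B LS4 LG b :=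
    fun b hb => (mem_ssPrefA'' hord').2 (mem_ssPrefA'_g.2 hb)
  by_cases h₀ : (SApp'.base a, SSch'.g a) ∈ M
  · refine hst (.p2 a) (.g a) (TAPSS.blocks_of_occupant _ (hpg (.p2 a) (by simp))
      (Or.inl (hun _ (by simp) (hne _ _ (by simp) h₀))) n₁ (ssPtype'_p2 a) one_pos h₀
      (fun c => huniq _ c h₀) ?_ ?_
      (prefersS_of_pair_sublist hord hord' (p2_base_sublist hord a) ?_ ?_ ?_ ?_)) <;>
      simp [ssOf'', ssPtype'_base, ssPtype'_p2, ssPrefA', n₁, n₂]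
  by_cases h₁ : (SApp'.p1 a, SSch'.g a) ∈ M
  · refine hst (.base a) (.g a) (TAPSS.blocks_of_occupant _ (hpg (.base a) (by simp))
      (Or.inl (hun _ (by simp) h₀)) n₃ (ssPtype'_base a) one_pos h₁
      (fun c => huniq _ c h₁) ?_ ?_
      (prefersS_of_pair_sublist hord hord' (base_p1_sublist_masterF hord a) ?_ ?_ ?_ ?_)) <;>
      simp [ssOf'', ssPtype'_base, ssPtype'_p1, ssPrefA', n₁.symm, n₃]
  by_cases h₂ : (SApp'.p2 a, SSch'.g a) ∈ M
  · refine hst (.p1 a) (.g a) (TAPSS.blocks_of_occupant _ (hpg (.p1 a) (by simp))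
      (Or.inl (hun _ (by simp) h₁)) n₂.symm (ssPtype'_p1 a) one_pos h₂
      (fun c => huniq _ c h₂) ?_ ?_
      (prefersS_of_pair_sublist hord hord' (p1_p2_sublist hord a) ?_ ?_ ?_ ?_)) <;>
      simp [ssOf'', ssPtype'_p1, ssPtype'_p2, ssPrefA', n₂.symm, n₃.symm]
  have hempty : ∀ p, (ssOf'' B LX1 LX2 LR1 LR2 LS4 LG).Undersub M (.g a) p := fun p => by
    refine TAPSS.undersub_of_forall _ one_pos fun b hb => ?_
    rcases mem_ssPrefA'_g.1 (hacc _ _ hb) with rfl | rfl | rfl <;> contradiction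
  exact hst (.base a) (.g a) ⟨hpg _ (by simp),
    Or.inl (hun _ (by simp) h₀), _, _, n₃, ssPtype'_base a, Or.inl ⟨hempty _, hempty _⟩⟩

theorem satisfies_of_stable (hord : ssOrderings n m LX1 LX2 LR1 LR2)
    (hord' : schoolOrderings n m LS4 LG)
    (hM : (ssOf'' B LX1 LX2 LR1 LR2 LS4 LG).Stable M) :
    B.Satisfies fun i => decide ((SApp'.base (.x i 0), SSch'.base (.y i 0)) ∈ M) := by
  have hbase := exists_base_mem_of_stable hord hord' hM
  obtain ⟨hM, hst⟩ := hM
  have huniq : ∀ a b c, (a, SSch'.base c) ∈ M → (b, SSch'.base c) ∈ M → a = b := by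
    intro a b c ha hb
    obtain ⟨a, rfl, -⟩ := mem_ssPrefA'_base.1 ((mem_ssPrefA'' hord').1 (hM.1.1 _ ha))
    obtain ⟨b, rfl, -⟩ := mem_ssPrefA'_base.1 ((mem_ssPrefA'' hord').1 (hM.1.1 _ hb))
    refine TAPSS.eq_of_mem_of_cap_le_one _ (p := .F) hM ?_ ha hb ?_ ?_
    · cases c <;> simp [ssOf'', ssCap', ssCap]
    · simp [ssOf'', ssPtype'_base]
    · simp [ssOf'', ssPtype'_base]
  have hw : ∀ j t, (SApp'.base (.w j t), SSch'.base (.s j t)) ∈ M ∨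
      (SApp'.base (.w j t), SSch'.base (.s4 j)) ∈ M := fun j t => by
    simpa [ssPrefA] using hbase (.w j t)
  have hq : ∀ j, ∃ t, (SApp'.base (.q j), SSch'.base (.s j t)) ∈ M := fun j => by
    obtain ⟨c, hc, h⟩ := hbase (.q j)
    simp only [ssPrefA, List.mem_cons, List.not_mem_nil, or_false] at hc
    rcases hc with rfl | rfl | rfl <;> exact ⟨_, h⟩
  have hs : ∀ i r j t, (SApp'.base (.x i r), SSch'.base (.s j t)) ∉ M := by
    intro i r j t hx
    obtain ⟨t', hq⟩ := hq j
    have h₁ : (SApp'.base (.w j t), SSch'.base (.s4 j)) ∈ M :=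
      (hw j t).resolve_left fun h => by simpa using huniq _ _ _ hx h
    have h₂ : (SApp'.base (.w j t'), SSch'.base (.s4 j)) ∈ M :=
      (hw j t').resolve_left fun h => by simpa using huniq _ _ _ hq h
    obtain rfl : t = t' := by simpa using huniq _ _ _ h₁ h₂
    simpa using huniq _ _ _ hx hq
  have hy : ∀ i r, (SApp'.base (.x i r), SSch'.base (.y i (firstY r))) ∈ M ∨
      (SApp'.base (.x i r), SSch'.base (.y i (lastY r))) ∈ M := by
    intro i r
    obtain ⟨c, hc, h⟩ := hbase (.x i r)
    simp only [ssPrefA_x, List.mem_cons, List.not_mem_nil, or_false] at hc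
    rcases hc with rfl | rfl | rfl
    · exact Or.inl h
    · obtain ⟨j, t, hjt, -⟩ := exists_sx_eq_s B i r
      exact absurd (hjt ▸ h) (hs i r j t)
    · exact Or.inr h
  have hne : ∀ i r r' k, r ≠ r' → (SApp'.base (.x i r), SSch'.base (.y i k)) ∈ M →
      (SApp'.base (.x i r'), SSch'.base (.y i k)) ∉ M := fun i r r' k h h₁ h₂ =>
    h (by simpa using huniq _ _ _ h₁ h₂)
  intro j
  obtain ⟨t, hq⟩ := hq j
  obtain ⟨i, r, hr, hcl⟩ := exists_eq_sx B j t
  refine ⟨t, ?_⟩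
  have hfirst : (SApp'.base (.x i r), SSch'.base (.y i (firstY r))) ∈ M := by
    refine (hy i r).resolve_right fun h => ?_
    have hx : SSch'.base (SSch.s j t) ∈ ssPrefA' B (.base (.x i r)) := by
      simp [ssPrefA', ssPrefA_x, hr]
    have hq' : SSch'.base (SSch.s j t) ∈ ssPrefA' B (.base (.q j)) := by
      fin_cases t <;> simp [ssPrefA', ssPrefA]
    refine hst (.base (.x i r)) (.base (.s j t)) (TAPSS.blocks_of_occupant _
      ((mem_ssPrefA'' hord').2 hx) (Or.inr ⟨_, h, prefersA_of_pair_sublist hord' ?_⟩)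
      (p := .I) (r := .F) (by simp) (ssPtype'_base (m := m) (.x i r)) one_pos hq
      (fun c hc => huniq _ _ _ hc hq) (by simp [ssOf'', ssPtype', ssPtype])
      (by simp [ssOf'', ssPtype', ssPtype])
      (prefersS_of_pair_sublist hord hord' (x_q_sublist_masterF i r j) hx hq' ?_ ?_))
    · simp [ssPrefA'', ssPrefA', ssPrefA_x, hr]
    · simp [ssPtype', ssPtype]
    · simp [ssPtype', ssPtype]
  rw [hcl]
  have h₀ := hy i 0
  have h₃ := hy i 3
  simp only [firstY, lastY] at h₀ h₃ hfirst
  fin_cases r <;> simp at h₀ h₃ hfirst ⊢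
  · exact hfirst
  · exact h₀.resolve_right (hne i 1 0 1 (by decide) hfirst)
  · exact hne i 3 0 0 (by decide) (h₃.resolve_right (hne i 2 3 3 (by decide) hfirst))
  · exact hne i 3 0 0 (by decide) hfirst

end StableToSat

section SatToStable

/-- The school of each original applicant in the matching built from the truth assignment `f`
and a choice `τ j` of a true literal in each clause `j`. -/
def satSchool (f : Fin n → Bool) (τ : Fin m → Fin 3) : SApp n m → SSch n m
  | .x i r => if f i then .y i r else .y i (r + 1)
  | .q j => .s j (τ j)
  | .w j t => if t = τ j then .s4 j else .s j t

theorem satSchool_injective (f : Fin n → Bool) (τ : Fin m → Fin 3) :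
    Function.Injective (satSchool f τ) := by
  intro a b h
  cases a <;> cases b <;> grind [satSchool]

theorem satSchool_x (f : Fin n → Bool) (τ : Fin m → Fin 3) (i : Fin n) (r : Fin 4) :
    satSchool f τ (.x i r) = .y i (if f i = decide (r.1 < 2) then firstY r else lastY r) := by
  cases h : f i <;> fin_cases r <;> simp [satSchool, h, firstY, lastY]

theorem satSchool_mem (B : E3SAT n m) (f : Fin n → Bool) (τ : Fin m → Fin 3) (a : SApp n m) :
    satSchool f τ a ∈ ssPrefA B a := by
  rcases a with ⟨i, r⟩ | j | ⟨j, t⟩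
  · rw [satSchool_x, ssPrefA_x]
    split_ifs <;> simp
  · simp only [satSchool, ssPrefA]
    generalize τ j = t
    fin_cases t <;> simp
  · simp only [satSchool, ssPrefA]
    split_ifs <;> simp

/-- The matching built from `satSchool`; each `p1 a` goes to `g a`, and each `p2 a` is
unassigned. -/
def satMatching (f : Fin n → Bool) (τ : Fin m → Fin 3) : Finset (SApp' n m × SSch' n m) :=
  ((Xlist n m ++ Qlist n m ++ Wlist n m).flatMap fun a =>
    [(SApp'.base a, SSch'.base (satSchool f τ a)), (SApp'.p1 a, SSch'.g a)]).toFinset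

theorem mem_satMatching {f : Fin n → Bool} {τ : Fin m → Fin 3} {x : SApp' n m × SSch' n m} :
    x ∈ satMatching f τ ↔
      ∃ a, x = (.base a, .base (satSchool f τ a)) ∨ x = (.p1 a, .g a) := by
  have h : ∀ a, a ∈ Xlist n m ++ Qlist n m ++ Wlist n m := fun a => by cases a <;> simp
  simp only [satMatching, List.mem_toFinset, List.mem_flatMap, h, true_and, List.mem_cons,
    List.not_mem_nil, or_false]

theorem eq_of_mem_satMatching {f : Fin n → Bool} {τ : Fin m → Fin 3} {a b : SApp' n m}
    {c : SSch' n m} (ha : (a, c) ∈ satMatching f τ) (hb : (b, c) ∈ satMatching f τ) : a = b := by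
  rw [mem_satMatching] at ha hb
  have := satSchool_injective f τ
  grind [Function.Injective]

theorem cap_eq_one_of_mem_satMatching {f : Fin n → Bool} {τ : Fin m → Fin 3} {a : SApp' n m}
    {c : SSch' n m} {p : Subj} (h : (a, c) ∈ satMatching f τ) (hp : p ∈ ssPtype' a) :
    ssCap' c p = 1 := by
  simp only [mem_satMatching, Prod.mk.injEq] at h
  obtain ⟨b, ⟨rfl, rfl⟩ | ⟨rfl, rfl⟩⟩ := h
  · rcases b with ⟨i, r⟩ | j | ⟨j, t⟩ <;> simp only [satSchool] <;> (try split_ifs) <;>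
      simp only [ssCap', ssCap] <;> cases p <;> simp_all [ssPtype', ssPtype]
  · rfl

theorem isMatching_satMatching (hord' : schoolOrderings n m LS4 LG)
    (f : Fin n → Bool) (τ : Fin m → Fin 3) :
    (ssOf'' B LX1 LX2 LR1 LR2 LS4 LG).IsMatching (satMatching f τ) := by
  refine ⟨⟨fun x hx => ?_, fun a c d hc hd => ?_⟩, fun c p => ?_⟩
  · refine (mem_ssPrefA'' hord').2 ?_
    obtain ⟨a, rfl | rfl⟩ := mem_satMatching.1 hx
    · simpa [ssPrefA'] using satSchool_mem B f τ a
    · simp [ssPrefA']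
  · rw [mem_satMatching] at hc hd
    grind
  · rcases Finset.eq_empty_or_nonempty
      ((ssOf'' B LX1 LX2 LR1 LR2 LS4 LG).Mp (satMatching f τ) c p) with h | ⟨a, ha⟩
    · simp [h]
    · rw [TAPSS.mem_Mp] at ha
      refine le_of_le_of_eq (Finset.card_le_one.2 fun b hb d hd => ?_)
        (cap_eq_one_of_mem_satMatching ha.1 ha.2).symm
      rw [TAPSS.mem_Mp] at hb hd
      exact eq_of_mem_satMatching hb.1 hd.1

theorem not_blocks_satMatching (hord : ssOrderings n m LX1 LX2 LR1 LR2)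
    {f : Fin n → Bool} {τ : Fin m → Fin 3} {a b : SApp' n m} {c : SSch' n m} (p : Subj)
    (hb : (b, c) ∈ satMatching f τ) (hpa : p ∈ ssPtype' a) (hpb : p ∈ ssPtype' b)
    (h : [b, a] <+ ssMaster' n m LX1 LX2 LR1 LR2 p) :
    ¬ (ssOf'' B LX1 LX2 LR1 LR2 LS4 LG).Blocks (satMatching f τ) a c := by
  refine TAPSS.not_blocks_of_full _ hpa (not_lt.2 ?_) fun d hd => ?_
  · refine (cap_eq_one_of_mem_satMatching hb hpb).le.trans (Finset.one_le_card.2 ⟨b, ?_⟩)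
    exact (TAPSS.mem_Mp _).2 ⟨hb, hpb⟩
  · obtain rfl := eq_of_mem_satMatching ((TAPSS.mem_Mp _).1 hd).1 hb
    exact not_prefersS_of_pair_sublist hord h

theorem stable_satMatching (hord : ssOrderings n m LX1 LX2 LR1 LR2)
    (hord' : schoolOrderings n m LS4 LG) {f : Fin n → Bool} {τ : Fin m → Fin 3}
    (hτ : ∀ j, f (B.clause j (τ j)).1 = (B.clause j (τ j)).2) :
    (ssOf'' B LX1 LX2 LR1 LR2 LS4 LG).Stable (satMatching f τ) := by
  have hbase : ∀ a, (SApp'.base a, SSch'.base (satSchool f τ a)) ∈ satMatching f τ :=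
    fun a => mem_satMatching.2 ⟨a, Or.inl rfl⟩
  have hp1 : ∀ a, (SApp'.p1 a, SSch'.g a) ∈ satMatching f τ :=
    fun a => mem_satMatching.2 ⟨a, Or.inr rfl⟩
  have hM := isMatching_satMatching (B := B) (LX1 := LX1) (LX2 := LX2) (LR1 := LR1)
    (LR2 := LR2) hord' f τ
  refine ⟨hM, fun a c hbl => ?_⟩
  have hc := (mem_ssPrefA'' hord').1 hbl.1
  have hpref : ∀ d, (a, d) ∈ satMatching f τ →
      (ssOf'' B LX1 LX2 LR1 LR2 LS4 LG).PrefersA a c d := by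
    intro d hd
    rcases hbl.2.1 with h | ⟨d', hd', h⟩
    · exact absurd hd (h d)
    · rwa [hM.1.2 a d d' hd hd']
  have hirr : (a, c) ∉ satMatching f τ := fun h => lt_irrefl _ (hpref c h).2.2
  rcases a with a | a | a
  · have hpref := hpref _ (hbase a)
    simp only [ssPrefA', List.mem_append, List.mem_map, List.mem_singleton] at hc
    rcases hc with ⟨c, hc, rfl⟩ | rfl
    swap
    · exact not_prefersA_of_pair_sublist hord' (base_g_sublist_schoolMaster B hord' _ _) hpref
    rcases a with ⟨i, r⟩ | j | ⟨j, t⟩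
    · rw [satSchool_x] at hpref
      simp only [ssPrefA_x, List.mem_cons, List.not_mem_nil, or_false] at hc
      split_ifs at hpref with h
      · rcases hc with rfl | rfl | rfl
        · exact lt_irrefl _ hpref.2.2
        · refine not_prefersA_of_reverse_sublist hord' ?_ hpref
          simp [ssPrefA'', ssPrefA', ssPrefA_x]
        · refine not_prefersA_of_reverse_sublist hord' ?_ hpref
          simp [ssPrefA'', ssPrefA', ssPrefA_x]
      · rcases hc with rfl | rfl | rfl
        · have hx : ∀ (r r' : Fin 4) (p : Subj),
              satSchool f τ (.x i r') = .y i (firstY r) → p ∈ ssPtype' (.base (SApp.x (m := m) i r)) →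
              [SApp'.base (.x i r'), SApp'.base (.x i r)] <+
                ssMaster' n m LX1 LX2 LR1 LR2 p →
              ¬ (ssOf'' B LX1 LX2 LR1 LR2 LS4 LG).Blocks (satMatching f τ)
                (.base (.x i r)) (.base (.y i (firstY r))) := fun r r' p hr hp hs =>
            not_blocks_satMatching hord p (b := .base (.x i r')) (hr ▸ hbase (.x i r')) hp hp hs
          cases hf : f i <;> fin_cases r <;> simp [hf] at h
          · exact hx 0 3 .I (by simp [satSchool, hf, firstY]) (by simp [ssPtype', ssPtype])
              (x_x_sublist_masterI i (by decide)) hbl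
          · exact hx 1 0 .F (by simp [satSchool, hf, firstY]) (by simp [ssPtype', ssPtype])
              (x_x_sublist_masterF i (by decide)) hbl
          · exact hx 2 3 .I (by simp [satSchool, hf, firstY]) (by simp [ssPtype', ssPtype])
              (x_x_sublist_masterI i (by decide)) hbl
          · exact hx 3 0 .F (by simp [satSchool, hf, firstY]) (by simp [ssPtype', ssPtype])
              (x_x_sublist_masterF i (by decide)) hbl
        · obtain ⟨j, t, hjt, hcl⟩ := exists_sx_eq_s B i r
          have ht : t ≠ τ j := by
            rintro rfl
            have := hτ j
            rw [hcl] at this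
            exact h this
          have hb := hbase (.w j t)
          rw [satSchool, if_neg ht, ← hjt] at hb
          exact not_blocks_satMatching hord .F hb (by simp [ssPtype', ssPtype])
            (by simp [ssPtype', ssPtype]) (w_x_sublist_masterF _ _ _ _) hbl
        · exact lt_irrefl _ hpref.2.2
    · obtain ⟨t, rfl⟩ : ∃ t, c = .s j t := by
        simp only [ssPrefA, List.mem_cons, List.not_mem_nil, or_false] at hc
        rcases hc with rfl | rfl | rfl <;> exact ⟨_, rfl⟩
      by_cases ht : t = τ j
      · exact hirr (by simpa [satSchool, ht] using hbase (.q j))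
      · have hb := hbase (.w j t)
        rw [satSchool, if_neg ht] at hb
        exact not_blocks_satMatching hord .F hb (by simp [ssPtype', ssPtype])
          (by simp [ssPtype', ssPtype]) (w_q_sublist_masterF _ _ _) hbl
    · by_cases ht : t = τ j
      · simp only [ssPrefA, List.mem_cons, List.not_mem_nil, or_false] at hc
        rcases hc with rfl | rfl
        · exact not_blocks_satMatching hord .M (by simpa [satSchool, ht] using hbase (.q j))
            (by simp [ssPtype', ssPtype]) (by simp [ssPtype', ssPtype]) (q_w_sublist_masterM _ _ _) hbl
        · exact hirr (by simpa [satSchool, ht] using hbase (.w j t))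
      · simp only [satSchool, if_neg ht] at hpref
        simp only [ssPrefA, List.mem_cons, List.not_mem_nil, or_false] at hc
        rcases hc with rfl | rfl
        · exact lt_irrefl _ hpref.2.2
        · refine not_prefersA_of_reverse_sublist hord' ?_ hpref
          simp [ssPrefA'', ssPrefA', ssPrefA]
  · obtain rfl : c = .g a := by simpa [ssPrefA'] using hc
    exact hirr (hp1 a)
  · obtain rfl : c = .g a := by simpa [ssPrefA'] using hc
    exact not_blocks_satMatching hord (sharedSubj a) (hp1 a) (by simp [ssPtype'_p2])
      (by simp [ssPtype'_p1]) (p1_p2_sublist hord a) hbl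

end SatToStable

end Masters

theorem stmt15 {n m : ℕ} (B : E3SAT n m) (LX1 LX2 LR1 LR2 : List (SApp' n m))
    (hord : ssOrderings n m LX1 LX2 LR1 LR2)
    (LS4 LG : List (SSch' n m)) (hord' : schoolOrderings n m LS4 LG) :
    (∀ a : SApp' n m,
      (ssOf'' B LX1 LX2 LR1 LR2 LS4 LG).prefA a =
        (schoolMaster B LS4 LG).filter
          (fun c => decide (c ∈ (ssOf'' B LX1 LX2 LR1 LR2 LS4 LG).prefA a))) ∧
    ((∃ f : Fin n → Bool, B.Satisfies f) ↔
      ∃ M : Finset (SApp' n m × SSch' n m),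
        (ssOf'' B LX1 LX2 LR1 LR2 LS4 LG).Stable M) := by
  refine ⟨fun a => ?_, ?_, ?_⟩
  · have h := ssPrefA''_eq_filter B hord' a
    simp only [ssOf'', mem_ssPrefA'' hord']
    exact h
  · rintro ⟨f, hf⟩
    choose τ hτ using hf
    exact ⟨_, stable_satMatching hord hord' hτ⟩
  · rintro ⟨M, hM⟩
    exact ⟨_, satisfies_of_stable hord hord' hM⟩
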